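/- arXiv:2504.17322 — 2 statements merged into one kernel-verified Lean document; each statement's English description precedes it below -/
import Mathlib

section
/- Let a, b, c be positive integers and let f : ℝ^a × ℝ^b × ℝ^c → ℝ be a measurable, nonnegative, Lebesgue-integrable joint density. Assume that f, f_Y, f_Z, f_{YZ}, f_{XZ} are positive and finite Lebesgue-almost everywhere. Then the (possibly infinite) Lebesgue integral ∫ (1 − π_0(x,y,z))² r_0(y,z) f(x,y,z) d(x,y,z) equals 0 if and only if f_{XZ}(x,z) · f_{YZ}(y,z) = f_Z(z) · f(x,y,z) for Lebesgue-almost every (x,y,z), i.e. if and only if π_0(x,y,z) = 1 for almost all (x,y,z). -/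
open MeasureTheory

/-- Marginal density of `Y`: `f_Y(y) = ∫∫ f(x,y,z) dx dz`. -/
noncomputable def margY {a b c : ℕ}
    (f : (Fin a → ℝ) × (Fin b → ℝ) × (Fin c → ℝ) → ℝ) (y : Fin b → ℝ) : ENNReal :=
  ∫⁻ q : (Fin a → ℝ) × (Fin c → ℝ), ENNReal.ofReal (f (q.1, y, q.2))

/-- Marginal density of `Z`: `f_Z(z) = ∫∫ f(x,y,z) dx dy`. -/
noncomputable def margZ {a b c : ℕ}
    (f : (Fin a → ℝ) × (Fin b → ℝ) × (Fin c → ℝ) → ℝ) (z : Fin c → ℝ) : ENNReal :=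
  ∫⁻ q : (Fin a → ℝ) × (Fin b → ℝ), ENNReal.ofReal (f (q.1, q.2, z))

/-- Marginal density of `(Y,Z)`: `f_{YZ}(y,z) = ∫ f(x,y,z) dx`. -/
noncomputable def margYZ {a b c : ℕ}
    (f : (Fin a → ℝ) × (Fin b → ℝ) × (Fin c → ℝ) → ℝ) (y : Fin b → ℝ) (z : Fin c → ℝ) :
    ENNReal :=
  ∫⁻ x : Fin a → ℝ, ENNReal.ofReal (f (x, y, z))

/-- Marginal density of `(X,Z)`: `f_{XZ}(x,z) = ∫ f(x,y,z) dy`. -/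
noncomputable def margXZ {a b c : ℕ}
    (f : (Fin a → ℝ) × (Fin b → ℝ) × (Fin c → ℝ) → ℝ) (x : Fin a → ℝ) (z : Fin c → ℝ) :
    ENNReal :=
  ∫⁻ y : Fin b → ℝ, ENNReal.ofReal (f (x, y, z))

/-- Unconditional density ratio `r₀(y,z) = f_Y(y) f_Z(z) / f_{YZ}(y,z)`. -/
noncomputable def r0 {a b c : ℕ}
    (f : (Fin a → ℝ) × (Fin b → ℝ) × (Fin c → ℝ) → ℝ) (y : Fin b → ℝ) (z : Fin c → ℝ) : ℝ :=
  (margY f y).toReal * (margZ f z).toReal / (margYZ f y z).toReal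

/-- Conditional density ratio `π₀(x,y,z) = f_{XZ}(x,z) f_{YZ}(y,z) / (f_Z(z) f(x,y,z))`. -/
noncomputable def pi0 {a b c : ℕ}
    (f : (Fin a → ℝ) × (Fin b → ℝ) × (Fin c → ℝ) → ℝ)
    (x : Fin a → ℝ) (y : Fin b → ℝ) (z : Fin c → ℝ) : ℝ :=
  (margXZ f x z).toReal * (margYZ f y z).toReal / ((margZ f z).toReal * f (x, y, z))

/-- the pseudo-likelihood ratio index
`∫ (1 − π₀)² r₀ f` vanishes iff `f_{XZ} f_{YZ} = f_Z f` a.e., i.e. iff `π₀ = 1` a.e. -/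
theorem I0_eq_zero_iff_conditional_independence
    (a b c : ℕ) (ha : 0 < a) (hb : 0 < b) (hc : 0 < c)
    (f : (Fin a → ℝ) × (Fin b → ℝ) × (Fin c → ℝ) → ℝ)
    (hf_meas : Measurable f) (hf_nonneg : ∀ p, 0 ≤ f p) (hf_int : Integrable f)
    (hf_pos : ∀ᵐ p : (Fin a → ℝ) × (Fin b → ℝ) × (Fin c → ℝ), 0 < f p)
    (hY : ∀ᵐ y : Fin b → ℝ, 0 < margY f y ∧ margY f y < ⊤)
    (hZ : ∀ᵐ z : Fin c → ℝ, 0 < margZ f z ∧ margZ f z < ⊤)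
    (hYZ : ∀ᵐ q : (Fin b → ℝ) × (Fin c → ℝ), 0 < margYZ f q.1 q.2 ∧ margYZ f q.1 q.2 < ⊤)
    (hXZ : ∀ᵐ q : (Fin a → ℝ) × (Fin c → ℝ), 0 < margXZ f q.1 q.2 ∧ margXZ f q.1 q.2 < ⊤) :
    ((∫⁻ p : (Fin a → ℝ) × (Fin b → ℝ) × (Fin c → ℝ),
        ENNReal.ofReal ((1 - pi0 f p.1 p.2.1 p.2.2) ^ 2 * r0 f p.2.1 p.2.2 * f p)) = 0 ↔
      ∀ᵐ p : (Fin a → ℝ) × (Fin b → ℝ) × (Fin c → ℝ),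
        margXZ f p.1 p.2.2 * margYZ f p.2.1 p.2.2 = margZ f p.2.2 * ENNReal.ofReal (f p)) ∧
    ((∫⁻ p : (Fin a → ℝ) × (Fin b → ℝ) × (Fin c → ℝ),
        ENNReal.ofReal ((1 - pi0 f p.1 p.2.1 p.2.2) ^ 2 * r0 f p.2.1 p.2.2 * f p)) = 0 ↔
      ∀ᵐ p : (Fin a → ℝ) × (Fin b → ℝ) × (Fin c → ℝ), pi0 f p.1 p.2.1 p.2.2 = 1) := by
  have hYZ' : ∀ᵐ p : (Fin a → ℝ) × (Fin b → ℝ) × (Fin c → ℝ),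
      0 < margYZ f p.2.1 p.2.2 ∧ margYZ f p.2.1 p.2.2 < ⊤ :=
    (Measure.quasiMeasurePreserving_snd (μ := (volume : Measure (Fin a → ℝ)))
      (ν := (volume : Measure ((Fin b → ℝ) × (Fin c → ℝ))))).ae hYZ
  have hY' : ∀ᵐ p : (Fin a → ℝ) × (Fin b → ℝ) × (Fin c → ℝ),
      0 < margY f p.2.1 ∧ margY f p.2.1 < ⊤ :=
    (Measure.quasiMeasurePreserving_snd (μ := (volume : Measure (Fin a → ℝ)))
      (ν := (volume : Measure ((Fin b → ℝ) × (Fin c → ℝ))))).ae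
      ((Measure.quasiMeasurePreserving_fst (μ := (volume : Measure (Fin b → ℝ)))
        (ν := (volume : Measure (Fin c → ℝ)))).ae hY)
  have hZ' : ∀ᵐ p : (Fin a → ℝ) × (Fin b → ℝ) × (Fin c → ℝ),
      0 < margZ f p.2.2 ∧ margZ f p.2.2 < ⊤ :=
    (Measure.quasiMeasurePreserving_snd (μ := (volume : Measure (Fin a → ℝ)))
      (ν := (volume : Measure ((Fin b → ℝ) × (Fin c → ℝ))))).ae
      ((Measure.quasiMeasurePreserving_snd (μ := (volume : Measure (Fin b → ℝ)))
        (ν := (volume : Measure (Fin c → ℝ)))).ae hZ)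
  have hXZ' : ∀ᵐ p : (Fin a → ℝ) × (Fin b → ℝ) × (Fin c → ℝ),
      0 < margXZ f p.1 p.2.2 ∧ margXZ f p.1 p.2.2 < ⊤ := by
    have hq : Measure.QuasiMeasurePreserving
        (Prod.map id Prod.snd : (Fin a → ℝ) × (Fin b → ℝ) × (Fin c → ℝ) →
          (Fin a → ℝ) × (Fin c → ℝ)) volume volume :=
      QuasiMeasurePreserving.prodMap
        (Measure.QuasiMeasurePreserving.id (volume : Measure (Fin a → ℝ)))
        (Measure.quasiMeasurePreserving_snd (μ := (volume : Measure (Fin b → ℝ)))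
          (ν := (volume : Measure (Fin c → ℝ))))
    exact hq.ae hXZ
  have hof : Measurable fun p => ENNReal.ofReal (f p) := hf_meas.ennreal_ofReal
  have mY : Measurable fun y : Fin b → ℝ => margY f y := by
    unfold margY
    exact Measurable.lintegral_prod_right'
      (f := fun t : (Fin b → ℝ) × ((Fin a → ℝ) × (Fin c → ℝ)) =>
        ENNReal.ofReal (f (t.2.1, t.1, t.2.2))) (hof.comp (by fun_prop))
  have mZ : Measurable fun z : Fin c → ℝ => margZ f z := by
    unfold margZ
    exact Measurable.lintegral_prod_right'
      (f := fun t : (Fin c → ℝ) × ((Fin a → ℝ) × (Fin b → ℝ)) =>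
        ENNReal.ofReal (f (t.2.1, t.2.2, t.1))) (hof.comp (by fun_prop))
  have mYZ : Measurable fun q : (Fin b → ℝ) × (Fin c → ℝ) => margYZ f q.1 q.2 := by
    unfold margYZ
    exact Measurable.lintegral_prod_right'
      (f := fun t : ((Fin b → ℝ) × (Fin c → ℝ)) × (Fin a → ℝ) =>
        ENNReal.ofReal (f (t.2, t.1.1, t.1.2))) (hof.comp (by fun_prop))
  have mXZ : Measurable fun q : (Fin a → ℝ) × (Fin c → ℝ) => margXZ f q.1 q.2 := by
    unfold margXZ
    exact Measurable.lintegral_prod_right'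
      (f := fun t : ((Fin a → ℝ) × (Fin c → ℝ)) × (Fin b → ℝ) =>
        ENNReal.ofReal (f (t.1.1, t.2, t.1.2))) (hof.comp (by fun_prop))
  have m1 : Measurable fun p : (Fin a → ℝ) × (Fin b → ℝ) × (Fin c → ℝ) =>
      (margY f p.2.1).toReal := (mY.comp (by fun_prop)).ennreal_toReal
  have m2 : Measurable fun p : (Fin a → ℝ) × (Fin b → ℝ) × (Fin c → ℝ) =>
      (margZ f p.2.2).toReal := (mZ.comp (by fun_prop)).ennreal_toReal
  have m3 : Measurable fun p : (Fin a → ℝ) × (Fin b → ℝ) × (Fin c → ℝ) =>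
      (margYZ f p.2.1 p.2.2).toReal := (mYZ.comp measurable_snd).ennreal_toReal
  have m4 : Measurable fun p : (Fin a → ℝ) × (Fin b → ℝ) × (Fin c → ℝ) =>
      (margXZ f p.1 p.2.2).toReal :=
    (mXZ.comp (measurable_fst.prodMk (measurable_snd.comp measurable_snd))).ennreal_toReal
  have m : Measurable fun p : (Fin a → ℝ) × (Fin b → ℝ) × (Fin c → ℝ) =>
      ENNReal.ofReal ((1 - pi0 f p.1 p.2.1 p.2.2) ^ 2 * r0 f p.2.1 p.2.2 * f p) := by
    refine Measurable.ennreal_ofReal ?_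
    exact (((measurable_const.sub ((m4.mul m3).div (m2.mul hf_meas))).pow_const 2).mul
      ((m1.mul m2).div m3)).mul hf_meas
  have key : ((∫⁻ p : (Fin a → ℝ) × (Fin b → ℝ) × (Fin c → ℝ),
        ENNReal.ofReal ((1 - pi0 f p.1 p.2.1 p.2.2) ^ 2 * r0 f p.2.1 p.2.2 * f p)) = 0 ↔
      ∀ᵐ p : (Fin a → ℝ) × (Fin b → ℝ) × (Fin c → ℝ), pi0 f p.1 p.2.1 p.2.2 = 1) := by
    rw [lintegral_eq_zero_iff m]
    refine Filter.eventually_congr ?_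
    filter_upwards [hf_pos, hY', hZ', hYZ'] with p h0 h1 h2 h3
    have h1' := ENNReal.toReal_pos h1.1.ne' h1.2.ne
    have h2' := ENNReal.toReal_pos h2.1.ne' h2.2.ne
    have h3' := ENNReal.toReal_pos h3.1.ne' h3.2.ne
    have hr : 0 < r0 f p.2.1 p.2.2 := by unfold r0; positivity
    rw [Pi.zero_apply, ENNReal.ofReal_eq_zero]
    constructor
    · intro h
      have hs : (1 - pi0 f p.1 p.2.1 p.2.2) ^ 2 ≤ 0 := by
        by_contra! hlt
        exact absurd h (not_le.mpr (by positivity))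
      have := pow_eq_zero_iff (two_ne_zero) |>.mp (le_antisymm hs (sq_nonneg _))
      linarith
    · intro h
      simp [h]
  refine ⟨key.trans (Filter.eventually_congr ?_), key⟩
  filter_upwards [hf_pos, hZ', hYZ', hXZ'] with p h0 h2 h3 h4
  have h2' := ENNReal.toReal_pos h2.1.ne' h2.2.ne
  have hd : (margZ f p.2.2).toReal * f p ≠ 0 := by positivity
  have e : pi0 f p.1 p.2.1 p.2.2 = (margXZ f p.1 p.2.2).toReal * (margYZ f p.2.1 p.2.2).toReal /
    ((margZ f p.2.2).toReal * f p) := rfl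
  rw [e, div_eq_one_iff_eq hd, ← ENNReal.toReal_eq_toReal_iff'
    (ENNReal.mul_ne_top h4.2.ne h3.2.ne) (ENNReal.mul_ne_top h2.2.ne ENNReal.ofReal_ne_top),
    ENNReal.toReal_mul, ENNReal.toReal_mul, ENNReal.toReal_ofReal h0.le]
end

section
/- Let a, b, c be positive integers and let f : ℝ^a × ℝ^b × ℝ^c → ℝ be a measurable, nonnegative, Lebesgue-integrable joint density. Assume that f, f_Y, f_Z, f_{YZ}, f_{XZ} are positive and finite Lebesgue-almost everywhere. Then for every bounded measurable g : ℝ^a × ℝ^b × ℝ^c → ℝ, ∫ g(x,y,z) · r_0(y,z) · π_0(x,y,z) · f(x,y,z) d(x,y,z) = ∫_{ℝ^b} ( ∫∫ g(x,y,z) f_{XZ}(x,z) dx dz ) f_Y(y) dy, both sides being finite. -/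
open MeasureTheory

theorem perm_mp (A B C : Type*) [MeasureSpace A] [MeasureSpace B] [MeasureSpace C]
    [SigmaFinite (volume : Measure A)] [SigmaFinite (volume : Measure B)]
    [SigmaFinite (volume : Measure C)] :
    MeasurePreserving (fun p : A × B × C => (p.2.1, (p.1, p.2.2))) := by
  have h1 : MeasurePreserving (MeasurableEquiv.prodAssoc : (A × B) × C ≃ᵐ A × B × C).symm :=
    (volume_preserving_prodAssoc (α₁ := A) (β₁ := B) (γ₁ := C)).symm _
  have h2 : MeasurePreserving (Prod.map Prod.swap id : (A × B) × C → (B × A) × C)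
      volume volume :=
    (Measure.measurePreserving_swap (μ := (volume : Measure A)) (ν := (volume : Measure B))).prod
      (MeasurePreserving.id (volume : Measure C))
  have h3 := volume_preserving_prodAssoc (α₁ := B) (β₁ := A) (γ₁ := C)
  exact (h3.comp h2).comp h1

/-- the key moment identity
`∫ g r₀ π₀ f = ∫ (∫∫ g f_{XZ} dx dz) f_Y dy`, both sides being finite,
for every bounded measurable `g`. -/
theorem moment_identity_conditional_ratio
    (a b c : ℕ) (ha : 0 < a) (hb : 0 < b) (hc : 0 < c)
    (f : (Fin a → ℝ) × (Fin b → ℝ) × (Fin c → ℝ) → ℝ)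
    (hf_meas : Measurable f) (hf_nonneg : ∀ p, 0 ≤ f p) (hf_int : Integrable f)
    (hf_pos : ∀ᵐ p : (Fin a → ℝ) × (Fin b → ℝ) × (Fin c → ℝ), 0 < f p)
    (hY : ∀ᵐ y : Fin b → ℝ, 0 < margY f y ∧ margY f y < ⊤)
    (hZ : ∀ᵐ z : Fin c → ℝ, 0 < margZ f z ∧ margZ f z < ⊤)
    (hYZ : ∀ᵐ q : (Fin b → ℝ) × (Fin c → ℝ), 0 < margYZ f q.1 q.2 ∧ margYZ f q.1 q.2 < ⊤)
    (hXZ : ∀ᵐ q : (Fin a → ℝ) × (Fin c → ℝ), 0 < margXZ f q.1 q.2 ∧ margXZ f q.1 q.2 < ⊤)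
    (g : (Fin a → ℝ) × (Fin b → ℝ) × (Fin c → ℝ) → ℝ)
    (hg_meas : Measurable g) (hg_bdd : ∃ M : ℝ, ∀ p, |g p| ≤ M) :
    Integrable (fun p : (Fin a → ℝ) × (Fin b → ℝ) × (Fin c → ℝ) =>
        g p * r0 f p.2.1 p.2.2 * pi0 f p.1 p.2.1 p.2.2 * f p) ∧
    Integrable (fun y : Fin b → ℝ =>
        (∫ q : (Fin a → ℝ) × (Fin c → ℝ), g (q.1, y, q.2) * (margXZ f q.1 q.2).toReal) *
          (margY f y).toReal) ∧
    (∫ p : (Fin a → ℝ) × (Fin b → ℝ) × (Fin c → ℝ),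
        g p * r0 f p.2.1 p.2.2 * pi0 f p.1 p.2.1 p.2.2 * f p)
      = ∫ y : Fin b → ℝ,
          (∫ q : (Fin a → ℝ) × (Fin c → ℝ), g (q.1, y, q.2) * (margXZ f q.1 q.2).toReal) *
            (margY f y).toReal := by
  obtain ⟨M, hM⟩ := hg_bdd
  have T1 := perm_mp (Fin a → ℝ) (Fin b → ℝ) (Fin c → ℝ)
  have T2 := perm_mp (Fin b → ℝ) (Fin a → ℝ) (Fin c → ℝ)
  have hF : Measurable (fun p : (Fin b → ℝ) × (Fin a → ℝ) × (Fin c → ℝ) =>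
      ENNReal.ofReal (f (p.2.1, (p.1, p.2.2)))) :=
    (hf_meas.comp T2.measurable).ennreal_ofReal
  have hFint : ∫⁻ p : (Fin b → ℝ) × (Fin a → ℝ) × (Fin c → ℝ),
      ENNReal.ofReal (f (p.2.1, (p.1, p.2.2))) ≠ ⊤ :=
    (T2.integrable_comp_of_integrable hf_int).lintegral_lt_top.ne
  have mY : Measurable (margY f) := hF.lintegral_prod_right'
  have mXZ : Measurable (fun q : (Fin a → ℝ) × (Fin c → ℝ) => margXZ f q.1 q.2) :=
    hF.lintegral_prod_left'
  have iY : Integrable (fun y => (margY f y).toReal) := by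
    refine integrable_toReal_of_lintegral_ne_top mY.aemeasurable ?_
    rw [Measure.volume_eq_prod, lintegral_prod _ hF.aemeasurable] at hFint
    exact hFint
  have iXZ : Integrable (fun q : (Fin a → ℝ) × (Fin c → ℝ) => (margXZ f q.1 q.2).toReal) := by
    refine integrable_toReal_of_lintegral_ne_top mXZ.aemeasurable ?_
    rw [Measure.volume_eq_prod, lintegral_prod_symm _ hF.aemeasurable] at hFint
    exact hFint
  have iH : Integrable (fun p : (Fin b → ℝ) × (Fin a → ℝ) × (Fin c → ℝ) =>
      g (p.2.1, (p.1, p.2.2)) * ((margY f p.1).toReal * (margXZ f p.2.1 p.2.2).toReal)) := by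
    refine Integrable.bdd_mul (c := M) (iY.mul_prod iXZ)
      (hg_meas.comp T2.measurable).aestronglyMeasurable (Filter.Eventually.of_forall fun p => ?_)
    exact hM _
  have aeEq : (fun p : (Fin a → ℝ) × (Fin b → ℝ) × (Fin c → ℝ) =>
        g p * r0 f p.2.1 p.2.2 * pi0 f p.1 p.2.1 p.2.2 * f p) =ᵐ[volume]
      (fun p => g p * ((margY f p.2.1).toReal * (margXZ f p.1 p.2.2).toReal)) := by
    have q1 : Measure.QuasiMeasurePreserving
        (fun p : (Fin a → ℝ) × (Fin b → ℝ) × (Fin c → ℝ) => p.2) volume volume :=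
      Measure.quasiMeasurePreserving_snd
    have q2 : Measure.QuasiMeasurePreserving
        (fun p : (Fin b → ℝ) × (Fin c → ℝ) => p.2) volume volume :=
      Measure.quasiMeasurePreserving_snd
    filter_upwards [hf_pos, q1.ae hYZ, (q2.comp q1).ae hZ] with p h1 h2 h3
    have k2 := (ENNReal.toReal_pos h2.1.ne' h2.2.ne).ne'
    have k3 := (ENNReal.toReal_pos h3.1.ne' h3.2.ne).ne'
    simp only [Function.comp] at k3
    have k1 := h1.ne'
    obtain ⟨x, y, z⟩ := p
    simp only [r0, pi0] at *
    field_simp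
  have hinner : ∀ y : Fin b → ℝ,
      (∫ q : (Fin a → ℝ) × (Fin c → ℝ), g (q.1, y, q.2) * (margXZ f q.1 q.2).toReal) *
          (margY f y).toReal =
      ∫ q : (Fin a → ℝ) × (Fin c → ℝ),
        g (q.1, y, q.2) * ((margY f y).toReal * (margXZ f q.1 q.2).toReal) := by
    intro y
    rw [← integral_mul_const]
    congr 1
    ext q
    ring
  simp only [hinner]
  refine ⟨(T1.integrable_comp_of_integrable iH).congr aeEq.symm, iH.integral_prod_left, ?_⟩
  rw [integral_congr_ae aeEq]
  have e2 := integral_prod _ iH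
  refine Eq.trans ?_ e2
  have e1 := integral_map (μ := volume) T1.measurable.aemeasurable
    (by rw [T1.map_eq]; exact iH.aestronglyMeasurable)
  rw [T1.map_eq] at e1
  exact e1.symm
end
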